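/- arXiv:2106.06756 — 3 statements merged into one kernel-verified Lean document; each statement's English description precedes it below -/
import Mathlib

section
/- Let F_q be a finite field and let B be an n×n symmetric matrix over F_q with n ≥ 3 whose epr-sequence begins NA, i.e., every diagonal entry of B is zero (ℓ_1 = N) and every 2×2 principal minor of B is nonzero (ℓ_2 = A). Then: (1) if F_q has characteristic 2, every 3×3 principal minor of B is zero (ℓ_3 = N); and (2) if F_q has characteristic different from 2, every 3×3 principal minor of B is nonzero (ℓ_3 = A). -/
open Matrix

/-- The `j`-th term of the epr-sequence of `B` is `A`: every `j × j`
principal submatrix of `B` is nonsingular. -/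
def eprA {F : Type*} [CommRing F] {n : ℕ} (B : Matrix (Fin n) (Fin n) F) (j : ℕ) : Prop :=
  ∀ f : Fin j → Fin n, Function.Injective f → (B.submatrix f f).det ≠ 0

/-- The `j`-th term of the epr-sequence of `B` is `N`: every `j × j`
principal submatrix of `B` is singular. -/
def eprN {F : Type*} [CommRing F] {n : ℕ} (B : Matrix (Fin n) (Fin n) F) (j : ℕ) : Prop :=
  ∀ f : Fin j → Fin n, Function.Injective f → (B.submatrix f f).det = 0

/-- A symmetric `3 × 3` principal minor with zero diagonal is twice the product of its
off-diagonal entries. -/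
theorem det_submatrix_three_of_diag_zero {R : Type*} [CommRing R] {n : ℕ}
    {B : Matrix (Fin n) (Fin n) R} (hsym : B.IsSymm) (hdiag : ∀ i, B i i = 0)
    (f : Fin 3 → Fin n) :
    (B.submatrix f f).det = 2 * (B (f 0) (f 1) * B (f 1) (f 2) * B (f 0) (f 2)) := by
  rw [det_fin_three]
  simp only [submatrix_apply, hdiag, hsym.apply (f 0) (f 1), hsym.apply (f 0) (f 2),
    hsym.apply (f 1) (f 2)]
  ring

theorem stmt7 {F : Type*} [Field F] [Fintype F] {n : ℕ} (hn : 3 ≤ n)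
    (B : Matrix (Fin n) (Fin n) F) (hsym : B.IsSymm)
    (h1 : eprN B 1) (h2 : eprA B 2) :
    (ringChar F = 2 → eprN B 3) ∧ (ringChar F ≠ 2 → eprA B 3) := by
  have hdiag : ∀ i, B i i = 0 := fun i => by
    simpa using h1 (fun _ => i) (Function.injective_of_subsingleton _)
  have hoff : ∀ i j, i ≠ j → B i j ≠ 0 := fun i j hij h0 => by
    refine h2 ![i, j] (injective_pair_iff_ne.mpr hij) ?_
    rw [det_fin_two]
    simp [hdiag, h0]
  refine ⟨fun hchar f _ => ?_, fun hchar f hf => ?_⟩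
  · have htwo : (2 : F) = 0 := by simpa [hchar] using ringChar.Nat.cast_ringChar (R := F)
    rw [det_submatrix_three_of_diag_zero hsym hdiag, htwo, zero_mul]
  · rw [det_submatrix_three_of_diag_zero hsym hdiag]
    exact mul_ne_zero (Ring.two_ne_zero hchar) (mul_ne_zero (mul_ne_zero
      (hoff _ _ (hf.ne (by decide))) (hoff _ _ (hf.ne (by decide))))
      (hoff _ _ (hf.ne (by decide))))
end

section
/- Let B be an n×n symmetric matrix over the field F_3 = Z/3Z whose epr-sequence begins NA, i.e., every diagonal entry of B is zero (ℓ_1 = N) and every 2×2 principal minor of B is nonzero (ℓ_2 = A). Then: (i) if n ≥ 7, then B has a singular 4×4 principal submatrix (ℓ_4 ∈ {N, S}); (ii) if n ≥ 19, then B has a nonsingular 5×5 principal submatrix (ℓ_5 ∈ {A, S}); and (iii) if n ≥ 49, then B has a nonsingular 6×6 principal submatrix (ℓ_6 ∈ {A, S}). -/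
open Matrix

/-- A symmetric matrix over `ZMod 3` with zero diagonal and nonzero off-diagonal entries. -/
structure IsSeidel {n : ℕ} (M : Matrix (Fin n) (Fin n) (ZMod 3)) : Prop where
  symm : ∀ i j, M i j = M j i
  diag : ∀ i, M i i = 0
  off : ∀ i j, i ≠ j → M i j = 1 ∨ M i j = -1

theorem IsSeidel.of_epr {n : ℕ} {B : Matrix (Fin n) (Fin n) (ZMod 3)} (hsym : B.IsSymm)
    (h1 : eprN B 1) (h2 : eprA B 2) : IsSeidel B := by
  have hd : ∀ i, B i i = 0 := fun i => by
    simpa using h1 (fun _ => i) (Function.injective_of_subsingleton _)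
  refine ⟨fun i j => (hsym.apply i j).symm, hd, fun i j hij => ?_⟩
  have h := h2 ![i, j] (by
    intro a b
    fin_cases a <;> fin_cases b <;> simp [hij, hij.symm])
  rw [det_fin_two] at h
  simp only [submatrix_apply, cons_val_zero, cons_val_one, hd, hsym.apply i j] at h
  revert h
  generalize B i j = x
  revert x
  decide

/-- Scaling by a sign and conjugating by a diagonal matrix of signs. -/
def signScale {n : ℕ} (c : ZMod 3) (d : Fin n → ZMod 3) (B : Matrix (Fin n) (Fin n) (ZMod 3)) :
    Matrix (Fin n) (Fin n) (ZMod 3) :=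
  of fun i j => c * d i * d j * B i j

theorem det_signScale_submatrix_eq_zero_iff {n k : ℕ} {c : ZMod 3} {d : Fin n → ZMod 3}
    (hc : c ≠ 0) (hd : ∀ i, d i ≠ 0) (B : Matrix (Fin n) (Fin n) (ZMod 3)) (f : Fin k → Fin n) :
    ((signScale c d B).submatrix f f).det = 0 ↔ (B.submatrix f f).det = 0 := by
  have : (signScale c d B).submatrix f f =
      c • (diagonal (d ∘ f) * B.submatrix f f * diagonal (d ∘ f)) := by
    ext i j
    simp [signScale]
    ring
  rw [this, det_smul, det_mul, det_mul, det_diagonal]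
  have hp : ∏ i, (d ∘ f) i ≠ 0 := Finset.prod_ne_zero_iff.2 fun i _ => hd _
  simp only [mul_eq_zero, hp, pow_eq_zero_iff', hc]
  simp

set_option synthInstance.maxSize 1000 in
theorem IsSeidel.signScale {n : ℕ} {c : ZMod 3} {d : Fin n → ZMod 3}
    (hc : c ≠ 0) (hd : ∀ i, d i ≠ 0) {B : Matrix (Fin n) (Fin n) (ZMod 3)} (hB : IsSeidel B) :
    IsSeidel (signScale c d B) := by
  refine ⟨fun i j => ?_, fun i => ?_, fun i j hij => ?_⟩
  · simp only [_root_.signScale, of_apply, hB.symm i j]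
    ring
  · simp [_root_.signScale, hB.diag]
  · simp only [_root_.signScale, of_apply]
    have h1 := hd i
    have h2 := hd j
    have h3 := hB.off i j hij
    have key : ∀ c a b x : ZMod 3, c ≠ 0 → a ≠ 0 → b ≠ 0 → (x = 1 ∨ x = -1) →
        c * a * b * x = 1 ∨ c * a * b * x = -1 := by decide
    exact key _ _ _ _ hc h1 h2 h3

/-- The normalized sign patterns of a vertex relative to a base triple. -/
def signPattern : Option (Fin 3) → Fin 3 → ZMod 3
  | none, _ => 1
  | some k, i => if i = k then -1 else 1

/-- The base triple `g` spans the matrix `J - I`, and every other vertex `x` is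
joined to it by the sign pattern `t x`. -/
structure IsNormalized {n : ℕ} (M : Matrix (Fin n) (Fin n) (ZMod 3)) (g : Fin 3 → Fin n)
    (t : Fin n → Option (Fin 3)) : Prop extends IsSeidel M where
  inj : Function.Injective g
  base : ∀ i j, i ≠ j → M (g i) (g j) = 1
  pat : ∀ i x, x ∉ Set.range g → M (g i) x = signPattern (t x) i

set_option synthInstance.maxSize 1000 in
theorem exists_sign_mul_eq_signPattern (a : Fin 3 → ZMod 3) (ha : ∀ i, a i = 1 ∨ a i = -1) :
    ∃ s : ZMod 3, s ≠ 0 ∧ ∃ t, ∀ i, s * a i = signPattern t i := by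
  have key : ∀ x y z : ZMod 3, (x = 1 ∨ x = -1) → (y = 1 ∨ y = -1) → (z = 1 ∨ z = -1) →
      ∃ s : ZMod 3, s ≠ 0 ∧ ∃ t : Option (Fin 3), s * x = signPattern t 0 ∧ s * y = signPattern t 1 ∧
        s * z = signPattern t 2 := by decide
  obtain ⟨s, hs, t, h0, h1, h2⟩ := key _ _ _ (ha 0) (ha 1) (ha 2)
  exact ⟨s, hs, t, by simp [Fin.forall_fin_succ, h0, h1, h2]⟩

theorem IsSeidel.exists_isNormalized {n : ℕ} {B : Matrix (Fin n) (Fin n) (ZMod 3)}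
    (hB : IsSeidel B) {g : Fin 3 → Fin n} (hg : Function.Injective g) :
    ∃ c d t, c ≠ 0 ∧ (∀ i, d i ≠ 0) ∧ IsNormalized (_root_.signScale c d B) g t := by
  have hbase : ∃ (c : ZMod 3) (b : Fin 3 → ZMod 3), c ≠ 0 ∧ (∀ i, b i ≠ 0) ∧
      ∀ i j, i ≠ j → c * b i * b j * B (g i) (g j) = 1 := by
    have key : ∀ x y z : ZMod 3, (x = 1 ∨ x = -1) → (y = 1 ∨ y = -1) → (z = 1 ∨ z = -1) →
        ∃ c b₁ b₂ : ZMod 3, c ≠ 0 ∧ b₁ ≠ 0 ∧ b₂ ≠ 0 ∧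
          c * b₁ * x = 1 ∧ c * b₂ * y = 1 ∧ c * b₁ * b₂ * z = 1 := by decide
    obtain ⟨c, b₁, b₂, hc, hb₁, hb₂, h01, h02, h12⟩ := key _ _ _
      (hB.off (g 0) (g 1) (hg.ne (by decide))) (hB.off (g 0) (g 2) (hg.ne (by decide)))
      (hB.off (g 1) (g 2) (hg.ne (by decide)))
    refine ⟨c, ![1, b₁, b₂], hc, by simp [Fin.forall_fin_succ, hb₁, hb₂], ?_⟩
    simp [Fin.forall_fin_succ, h01, h02, h12, hB.symm (g 1) (g 0), hB.symm (g 2) (g 0),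
      hB.symm (g 2) (g 1), mul_right_comm c b₂ b₁]
  obtain ⟨c, b, hc, hb, hbase⟩ := hbase
  have hext : ∀ x, ∃ s : ZMod 3, s ≠ 0 ∧ (∀ i, g i = x → s = b i) ∧
      ∃ t, x ∉ Set.range g → ∀ i, s * (c * b i * B (g i) x) = signPattern t i := by
    intro x
    by_cases hx : x ∈ Set.range g
    · obtain ⟨i, rfl⟩ := hx
      exact ⟨b i, hb i, fun j h => by rw [hg h], none, fun h => absurd ⟨i, rfl⟩ h⟩
    · obtain ⟨s, hs, t, ht⟩ := exists_sign_mul_eq_signPattern (fun i => c * b i * B (g i) x) (by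
        intro i
        have h1 := hb i
        have h2 := hB.off (g i) x fun h => hx ⟨i, h⟩
        have key : ∀ c y z : ZMod 3, c ≠ 0 → y ≠ 0 → (z = 1 ∨ z = -1) →
            c * y * z = 1 ∨ c * y * z = -1 := by decide
        exact key _ _ _ hc h1 h2)
      exact ⟨s, hs, fun i h => absurd ⟨i, h⟩ hx, t, fun _ => ht⟩
  choose d hd hdb t ht using hext
  refine ⟨c, d, t, hc, hd, hB.signScale hc hd, hg, fun i j hij => ?_, fun i x hx => ?_⟩
  · simp only [_root_.signScale, of_apply, hdb _ _ rfl, hbase i j hij]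
  · rw [← ht x hx i]
    simp only [_root_.signScale, of_apply, hdb _ i rfl]
    ring

/-- Entries of the Schur complement of the base triple. -/
def schurEntry {n : ℕ} (M : Matrix (Fin n) (Fin n) (ZMod 3)) (t : Fin n → Option (Fin 3)) :
    Matrix (Fin n) (Fin n) (ZMod 3) :=
  of fun x y => M x y + (∑ i, signPattern (t x) i) * (∑ i, signPattern (t y) i) +
    ∑ i, signPattern (t x) i * signPattern (t y) i

namespace IsNormalized

variable {n : ℕ} {M : Matrix (Fin n) (Fin n) (ZMod 3)} {g : Fin 3 → Fin n}
  {t : Fin n → Option (Fin 3)}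

theorem det_append (hM : IsNormalized M g t) {k : ℕ} (h : Fin k → Fin n)
    (hh : ∀ i, h i ∉ Set.range g) :
    (M.submatrix (Fin.append g h) (Fin.append g h)).det =
      -((schurEntry M t).submatrix h h).det := by
  let A : Matrix (Fin 3) (Fin 3) (ZMod 3) := !![0, 1, 1; 1, 0, 1; 1, 1, 0]
  let A' : Matrix (Fin 3) (Fin 3) (ZMod 3) := !![1, -1, -1; -1, 1, -1; -1, -1, 1]
  let V : Matrix (Fin 3) (Fin k) (ZMod 3) := of fun i x => signPattern (t (h x)) i
  have hA : A' * A = 1 := by decide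
  have hA2 : A * A' = 1 := by decide
  let : Invertible A := ⟨A', hA, hA2⟩
  have hblock : (M.submatrix (Fin.append g h) (Fin.append g h)).submatrix
      finSumFinEquiv finSumFinEquiv = fromBlocks A V Vᵀ (M.submatrix h h) := by
    ext (i | i) (j | j)
    · by_cases hij : i = j
      · subst hij
        simp only [submatrix_apply, finSumFinEquiv_apply_left, Fin.append_left,
          fromBlocks_apply₁₁, hM.diag]
        fin_cases i <;> rfl
      · simp only [submatrix_apply, finSumFinEquiv_apply_left, Fin.append_left,
          fromBlocks_apply₁₁, hM.base i j hij]
        fin_cases i <;> fin_cases j <;> first | rfl | exact absurd rfl hij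
    · simp [V, hM.pat _ _ (hh _)]
    · simp [V, hM.symm (h i), hM.pat _ _ (hh _)]
    · simp
  rw [← det_submatrix_equiv_self finSumFinEquiv, hblock, det_fromBlocks₁₁]
  have hdet : A.det = -1 := by decide
  have hinv : ⅟A = A' := rfl
  rw [hdet, neg_one_mul, hinv]
  congr 2
  ext x y
  simp [V, A', schurEntry, mul_apply, Fin.sum_univ_three]
  have h3 : (3 : ZMod 3) = 0 := by decide
  linear_combination (-(signPattern (t (h x)) 0 * signPattern (t (h y)) 0 +
    signPattern (t (h x)) 1 * signPattern (t (h y)) 1 +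
    signPattern (t (h x)) 2 * signPattern (t (h y)) 2)) * h3

theorem schurEntry_self (hM : IsNormalized M g t) (x : Fin n) :
    schurEntry M t x x = if t x = none then 0 else 1 := by
  simp only [schurEntry, of_apply, hM.diag]
  generalize t x = a
  revert a
  decide

theorem schurEntry_of_eq_none {x y : Fin n} (hx : t x = none) (hy : t y = none) :
    schurEntry M t x y = M x y := by
  simp only [schurEntry, of_apply, hx, hy, add_assoc]
  rw [add_eq_left]
  decide

theorem schurEntry_of_eq_some {x y : Fin n} {k : Fin 3} (hx : t x = some k)
    (hy : t y = some k) : schurEntry M t x y = M x y + 1 := by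
  simp only [schurEntry, of_apply, hx, hy, add_assoc]
  congr 1
  clear hx hy
  revert k
  decide

theorem append_injective (hM : IsNormalized M g t) {k : ℕ} {h : Fin k → Fin n}
    (hinj : Function.Injective h) (hh : ∀ i, h i ∉ Set.range g) :
    Function.Injective (Fin.append g h) :=
  Fin.append_injective_iff.2 ⟨hM.inj, hinj, fun i j hij => hh j ⟨i, hij⟩⟩

/-- Some sign pattern is shared by `k` vertices outside the base triple, because the `n - 3`
vertices outside the base triple are distributed among four patterns. -/
theorem exists_fiber (hM : IsNormalized M g t) {k : ℕ} (hk : 0 < k) (hn : 4 * k ≤ n) :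
    ∃ (a : Option (Fin 3)) (h : Fin k → Fin n), Function.Injective h ∧
      (∀ i, h i ∉ Set.range g) ∧ ∀ i, t (h i) = a := by
  classical
  have hcard : (Finset.univ.image g)ᶜ.card = n - 3 := by
    rw [Finset.card_compl, Finset.card_image_of_injective _ hM.inj]
    simp
  obtain ⟨a, -, ha⟩ := Finset.exists_lt_card_fiber_of_mul_lt_card_of_maps_to
    (s := (Finset.univ.image g)ᶜ) (t := Finset.univ) (f := t) (n := k - 1)
    (fun _ _ => Finset.mem_univ _) (by
      rw [hcard, Finset.card_univ, Fintype.card_option, Fintype.card_fin]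
      omega)
  obtain ⟨u, hu, huk⟩ := Finset.exists_subset_card_eq (Nat.le_of_pred_lt ha)
  let e := (u.equivFinOfCardEq huk).symm
  have hmem : ∀ i, (e i : Fin n) ∉ Set.range g ∧ t (e i) = a := fun i => by
    simpa using hu (e i).2
  exact ⟨a, fun i => e i, Subtype.val_injective.comp e.injective, fun i => (hmem i).1,
    fun i => (hmem i).2⟩

theorem exists_det_four_eq_zero (hM : IsNormalized M g t) (hn : 7 ≤ n) :
    ∃ f : Fin 4 → Fin n, Function.Injective f ∧ (M.submatrix f f).det = 0 := by
  by_cases hnone : ∃ x, x ∉ Set.range g ∧ t x = none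
  · obtain ⟨x, hx, htx⟩ := hnone
    refine ⟨Fin.append g ![x], hM.append_injective (Function.injective_of_subsingleton _)
      (by simpa using hx), ?_⟩
    rw [hM.det_append _ (by simpa using hx)]
    rw [det_fin_one]
    simp [hM.schurEntry_self, htx]
  · have hcard : (Finset.univ.image g)ᶜ.card = n - 3 := by
      rw [Finset.card_compl, Finset.card_image_of_injective _ hM.inj]
      simp
    obtain ⟨x, hx, y, hy, hxy, hty⟩ := Finset.exists_ne_map_eq_of_card_lt_of_maps_to
      (s := (Finset.univ.image g)ᶜ) (t := Finset.univ.erase none) (f := t)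
      (by rw [hcard]; simp; omega) (by
        intro x hx
        simp only [Finset.coe_erase, Finset.coe_univ, Set.mem_sdiff, Set.mem_univ, true_and,
          Set.mem_singleton_iff]
        exact fun h => hnone ⟨x, by simpa using hx, h⟩)
    have hx : x ∉ Set.range g := by simpa using hx
    have hy : y ∉ Set.range g := by simpa using hy
    obtain ⟨k, hk⟩ := Option.ne_none_iff_exists'.1 fun h => hnone ⟨x, hx, h⟩
    have hky : t y = some k := hty ▸ hk
    have hsub : ∀ (i j : Fin 3), i ≠ j → Function.Injective ![g i, g j, x, y] ∧
        M.submatrix ![g i, g j, x, y] ![g i, g j, x, y] =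
          !![0, 1, signPattern (some k) i, signPattern (some k) i;
             1, 0, signPattern (some k) j, signPattern (some k) j;
             signPattern (some k) i, signPattern (some k) j, 0, M x y;
             signPattern (some k) i, signPattern (some k) j, M x y, 0] := by
      intro i j hij
      have hgij := hM.inj.ne hij
      have hgx : ∀ i, g i ≠ x := fun i h => hx ⟨i, h⟩
      have hgy : ∀ i, g i ≠ y := fun i h => hy ⟨i, h⟩
      constructor
      · intro a b
        fin_cases a <;> fin_cases b <;>
          simp [hgij, hgij.symm, hgx, hgy, (hgx _).symm, (hgy _).symm, hxy, hxy.symm]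
      · ext a b
        fin_cases a <;> fin_cases b <;>
          simp [hM.diag, hM.base _ _ hij, hM.base _ _ hij.symm, hM.pat _ _ hx, hM.pat _ _ hy,
            hM.symm x (g _), hM.symm y (g _), hM.symm y x, hk, hky]
    rcases hM.off x y hxy with hone | hone
    · refine ⟨_, (hsub (k + 1) (k + 2) (by clear * -; revert k; decide)).1, ?_⟩
      rw [(hsub (k + 1) (k + 2) (by clear * -; revert k; decide)).2, hone]
      clear * -
      revert k
      decide
    · refine ⟨_, (hsub k (k + 1) (by clear * -; revert k; decide)).1, ?_⟩
      rw [(hsub k (k + 1) (by clear * -; revert k; decide)).2, hone]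
      clear * -
      revert k
      decide

theorem exists_det_five_ne_zero (hM : IsNormalized M g t) (hn : 12 ≤ n) :
    ∃ f : Fin 5 → Fin n, Function.Injective f ∧ (M.submatrix f f).det ≠ 0 := by
  by_contra! hzero
  obtain ⟨a, h, hinj, hg, ha⟩ := hM.exists_fiber (k := 3) (by decide) hn
  have hpair : ∀ i j, i ≠ j → a ≠ none ∧ M (h i) (h j) = 1 := by
    intro i j hij
    have hinj2 : Function.Injective ![h i, h j] := by
      intro p q
      fin_cases p <;> fin_cases q <;> simp [hinj.eq_iff, hij, hij.symm]
    have hg2 : ∀ p, ![h i, h j] p ∉ Set.range g := by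
      intro p
      fin_cases p <;> simpa using hg _
    have hdet := hM.det_append _ hg2
    rw [hzero _ (hM.append_injective hinj2 hg2), det_fin_two] at hdet
    have hoff := hM.off _ _ (hinj.ne hij)
    rcases a with - | k
    · simp [hM.schurEntry_self, ha, schurEntry_of_eq_none, hM.symm (h j) (h i)] at hdet
      rcases hoff with h | h <;> simp [h] at hdet
    · simp [hM.schurEntry_self, ha, schurEntry_of_eq_some (ha _) (ha _),
        hM.symm (h j) (h i)] at hdet
      refine ⟨by simp, ?_⟩
      revert hdet hoff
      generalize M (h i) (h j) = x
      clear * -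
      revert x
      decide
  obtain ⟨k, rfl⟩ := Option.ne_none_iff_exists'.1 (hpair 0 1 (by decide)).1
  have hh : ∀ i j, i ≠ j → M (h i) (h j) = 1 := fun i j hij => (hpair i j hij).2
  have hgh : ∀ i j, i ≠ k → M (g i) (h j) = 1 := fun i j hi => by
    simp [hM.pat _ _ (hg j), ha, signPattern, hi]
  let b : Fin 2 → Fin n := ![g (k + 1), g (k + 2)]
  have hb : ∀ i, ∃ l, l ≠ k ∧ b i = g l := by
    intro i
    fin_cases i
    · exact ⟨k + 1, by clear * -; revert k; decide, rfl⟩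
    · exact ⟨k + 2, by clear * -; revert k; decide, rfl⟩
  have hk12 : k + 1 ≠ k + 2 := by clear * -; revert k; decide
  have hbinj : Function.Injective b := by
    intro p q
    fin_cases p <;> fin_cases q <;> simp [b, hM.inj.eq_iff]
  have hf : Function.Injective (Fin.append b h) :=
    Fin.append_injective_iff.2 ⟨hbinj, hinj, fun i j hij => by
      obtain ⟨l, -, hl⟩ := hb i
      exact hg j ⟨l, hl ▸ hij⟩⟩
  have hone : ∀ p q, p ≠ q → M (Fin.append b h p) (Fin.append b h q) = 1 := by
    intro p q
    refine Fin.addCases (fun i => ?_) (fun i => ?_) p <;>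
      refine Fin.addCases (fun j => ?_) (fun j => ?_) q <;> intro hpq
    · obtain ⟨l, -, hl⟩ := hb i
      obtain ⟨m, -, hm⟩ := hb j
      have : b i ≠ b j := hbinj.ne fun h => hpq (by rw [h])
      rw [Fin.append_left, Fin.append_left, hl, hm]
      exact hM.base _ _ fun h => this (by rw [hl, hm, h])
    · obtain ⟨l, hlk, hl⟩ := hb i
      rw [Fin.append_left, Fin.append_right, hl, hgh _ _ hlk]
    · obtain ⟨l, hlk, hl⟩ := hb j
      rw [Fin.append_left, Fin.append_right, hl, hM.symm, hgh _ _ hlk]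
    · rw [Fin.append_right, Fin.append_right]
      exact hh _ _ fun h => hpq (by rw [h])
  have hmat : M.submatrix (Fin.append b h) (Fin.append b h) =
      of fun i j : Fin 5 => if i = j then (0 : ZMod 3) else 1 := by
    ext p q
    by_cases hpq : p = q
    · simp [hpq, hM.diag]
    · simp [hpq, hone p q hpq]
  have := hzero _ hf
  rw [hmat] at this
  revert this
  decide +kernel

theorem exists_det_six_ne_zero (hM : IsNormalized M g t) (hn : 20 ≤ n) :
    ∃ f : Fin 6 → Fin n, Function.Injective f ∧ (M.submatrix f f).det ≠ 0 := by
  by_contra! hzero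
  obtain ⟨a, h, hinj, hg, ha⟩ := hM.exists_fiber (k := 5) (by decide) hn
  have hoff : ∀ i j, i ≠ j → M (h i) (h j) = 1 ∨ M (h i) (h j) = -1 :=
    fun i j hij => hM.off _ _ (hinj.ne hij)
  have htriple : ∀ i j k, i ≠ j → i ≠ k → j ≠ k →
      M (h i) (h j) = 1 ∧ M (h i) (h k) = -1 ∧ M (h j) (h k) = -1 ∨
      M (h i) (h j) = -1 ∧ M (h i) (h k) = 1 ∧ M (h j) (h k) = -1 ∨
      M (h i) (h j) = -1 ∧ M (h i) (h k) = -1 ∧ M (h j) (h k) = 1 := by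
    intro i j k hij hik hjk
    have hinj3 : Function.Injective ![h i, h j, h k] := by
      intro p q
      fin_cases p <;> fin_cases q <;>
        simp [hinj.eq_iff, hij, hij.symm, hik, hik.symm, hjk, hjk.symm]
    have hg3 : ∀ p, ![h i, h j, h k] p ∉ Set.range g := by
      intro p
      fin_cases p <;> simpa using hg _
    have hdet := hM.det_append _ hg3
    rw [hzero _ (hM.append_injective hinj3 hg3), det_fin_three] at hdet
    have hoij := hoff _ _ hij
    have hoik := hoff _ _ hik
    have hojk := hoff _ _ hjk
    rcases a with - | l
    · simp [hM.schurEntry_self, ha, schurEntry_of_eq_none, hM.symm (h j) (h i),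
        hM.symm (h k) (h i), hM.symm (h k) (h j)] at hdet
      rcases hoij with h1 | h1 <;> rcases hoik with h2 | h2 <;> rcases hojk with h3 | h3 <;>
        rw [h1, h2, h3] at hdet <;> exact absurd hdet (by decide)
    · simp [hM.schurEntry_self, ha, schurEntry_of_eq_some (ha _) (ha _), hM.symm (h j) (h i),
        hM.symm (h k) (h i), hM.symm (h k) (h j)] at hdet
      rcases hoij with h1 | h1 <;> rcases hoik with h2 | h2 <;> rcases hojk with h3 | h3 <;>
        rw [h1, h2, h3] at hdet ⊢ <;> revert hdet <;> decide
  have hne : (1 : ZMod 3) ≠ -1 := by decide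
  have h012 := htriple 0 1 2 (by decide) (by decide) (by decide)
  have h013 := htriple 0 1 3 (by decide) (by decide) (by decide)
  have h014 := htriple 0 1 4 (by decide) (by decide) (by decide)
  have h023 := htriple 0 2 3 (by decide) (by decide) (by decide)
  have h024 := htriple 0 2 4 (by decide) (by decide) (by decide)
  have h034 := htriple 0 3 4 (by decide) (by decide) (by decide)
  have h123 := htriple 1 2 3 (by decide) (by decide) (by decide)
  have h124 := htriple 1 2 4 (by decide) (by decide) (by decide)
  have h134 := htriple 1 3 4 (by decide) (by decide) (by decide)
  have h234 := htriple 2 3 4 (by decide) (by decide) (by decide)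
  grind

end IsNormalized

theorem stmt9 {n : ℕ} (B : Matrix (Fin n) (Fin n) (ZMod 3)) (hsym : B.IsSymm)
    (h1 : eprN B 1) (h2 : eprA B 2) :
    (7 ≤ n → ∃ f : Fin 4 → Fin n, Function.Injective f ∧ (B.submatrix f f).det = 0) ∧
    (19 ≤ n → ∃ f : Fin 5 → Fin n, Function.Injective f ∧ (B.submatrix f f).det ≠ 0) ∧
    (49 ≤ n → ∃ f : Fin 6 → Fin n, Function.Injective f ∧ (B.submatrix f f).det ≠ 0) := by
  have hnorm (hn : 7 ≤ n) := (IsSeidel.of_epr hsym h1 h2).exists_isNormalized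
    (Fin.castLE_injective (show 3 ≤ n by omega))
  refine ⟨fun hn => ?_, fun hn => ?_, fun hn => ?_⟩ <;>
    obtain ⟨c, d, t, hc, hd, hM⟩ := hnorm (by omega)
  · obtain ⟨f, hf, hdet⟩ := hM.exists_det_four_eq_zero hn
    exact ⟨f, hf, (det_signScale_submatrix_eq_zero_iff hc hd B f).1 hdet⟩
  · obtain ⟨f, hf, hdet⟩ := hM.exists_det_five_ne_zero (by omega)
    exact ⟨f, hf, (det_signScale_submatrix_eq_zero_iff hc hd B f).not.1 hdet⟩
  · obtain ⟨f, hf, hdet⟩ := hM.exists_det_six_ne_zero (by omega)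
    exact ⟨f, hf, (det_signScale_submatrix_eq_zero_iff hc hd B f).not.1 hdet⟩
end

section
/- Let B be an n×n symmetric matrix over the field F_3 = Z/3Z with n ≥ 4 such that: every diagonal entry of B is zero (ℓ_1 = N), every 2×2 principal minor of B is nonzero (ℓ_2 = A), and every 4×4 principal minor of B is nonzero (ℓ_4 = A). Then n ≤ 6 and the epr-sequence of B is NAAA (if n = 4), NAAAN (if n = 5), or NAAANA (if n = 6); in particular, every 3×3 principal minor of B is nonzero, every 5×5 principal minor of B is zero when n ≥ 5, and B is nonsingular when n = 6. -/
open Matrix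

namespace ZMod

lemma eq_neg_of_ne_three {a b : ZMod 3} (ha : a ≠ 0) (hb : b ≠ 0) (hab : a ≠ b) : a = -b := by
  revert a b; decide

lemma sq_eq_one_three {a : ZMod 3} (ha : a ≠ 0) : a * a = 1 := by
  revert a; decide

lemma cross_mul_eq_of_mul_eq {a b c d : ZMod 3} (ha : a ≠ 0) (hb : b ≠ 0)
    (h : a * c = b * d) : a * d = b * c := by
  linear_combination -(a * b * h) - a * d * sq_eq_one_three hb + b * c * sq_eq_one_three ha

set_option synthInstance.maxHeartbeats 200000 in
set_option synthInstance.maxSize 1000 in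
lemma add_eq_zero_of_no_three_eq {a b c d : ZMod 3} (ha : a ≠ 0) (hb : b ≠ 0) (hc : c ≠ 0)
    (hd : d ≠ 0) (habc : ¬ (a = b ∧ a = c)) (habd : ¬ (a = b ∧ a = d))
    (hacd : ¬ (a = c ∧ a = d)) (hbcd : ¬ (b = c ∧ b = d)) : a + b + c + d = 0 := by
  decide +revert

lemma exists_three_eq_of_five {y : Fin 5 → ZMod 3} (hy : ∀ i, y i ≠ 0) :
    ∃ i j k, i ≠ j ∧ i ≠ k ∧ j ≠ k ∧ y i = y j ∧ y i = y k := by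
  have hcard : Fintype.card {a : ZMod 3 // a ≠ 0} * 2 < Fintype.card (Fin 5) := by decide
  obtain ⟨a, ha⟩ := Fintype.exists_lt_card_fiber_of_mul_lt_card
    (fun i => (⟨y i, hy i⟩ : {a : ZMod 3 // a ≠ 0})) hcard
  obtain ⟨i, j, k, hi, hj, hk, hij, hik, hjk⟩ := Finset.two_lt_card_iff.1 ha
  simp only [Finset.mem_filter, Finset.mem_univ, true_and, Subtype.ext_iff] at hi hj hk
  exact ⟨i, j, k, hij, hik, hjk, hi.trans hj.symm, hi.trans hk.symm⟩

end ZMod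

lemma Matrix.det_hollow_fin_four {R : Type*} [CommRing R] (a b c d e f : R) :
    (!![0, a, b, c; a, 0, d, e; b, d, 0, f; c, e, f, 0] : Matrix (Fin 4) (Fin 4) R).det =
      (a * f) ^ 2 + (b * e) ^ 2 + (c * d) ^ 2
        - 2 * (a * f * (b * e) + a * f * (c * d) + b * e * (c * d)) := by
  simp [Matrix.det_succ_row_zero, Fin.sum_univ_succ, Fin.succAbove]
  ring

section HollowSymmetric

variable {n : ℕ} {B : Matrix (Fin n) (Fin n) (ZMod 3)}

lemma eprN.apply_self (h1 : eprN B 1) (i : Fin n) : B i i = 0 := by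
  have h := h1 (fun _ => i) (Function.injective_of_subsingleton _)
  rwa [Matrix.det_fin_one] at h

lemma eprA.apply_ne_zero (h1 : eprN B 1) (h2 : eprA B 2) {i j : Fin n} (hij : i ≠ j) :
    B i j ≠ 0 := by
  intro h
  refine h2 ![i, j] ?_ ?_
  · intro a b; fin_cases a <;> fin_cases b <;> simp [hij, hij.symm]
  · rw [Matrix.det_fin_two]
    simp [h1.apply_self, h]

lemma eprA.not_matching_products_eq (hsym : B.IsSymm) (h1 : eprN B 1) (h4 : eprA B 4)
    {i j k l : Fin n} (hij : i ≠ j) (hik : i ≠ k) (hil : i ≠ l) (hjk : j ≠ k) (hjl : j ≠ l)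
    (hkl : k ≠ l) :
    ¬ (B i j * B k l = B i k * B j l ∧ B i j * B k l = B i l * B j k) := by
  rintro ⟨h, h'⟩
  refine h4 ![i, j, k, l] ?_ ?_
  · intro a b
    fin_cases a <;> fin_cases b <;>
      simp [hij, hij.symm, hik, hik.symm, hil, hil.symm, hjk, hjk.symm, hjl, hjl.symm, hkl,
        hkl.symm]
  · have h3 : (3 : ZMod 3) = 0 := by decide
    have hM : B.submatrix ![i, j, k, l] ![i, j, k, l] =
        !![0, B i j, B i k, B i l; B i j, 0, B j k, B j l;
          B i k, B j k, 0, B k l; B i l, B j l, B k l, 0] := by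
      ext a b
      fin_cases a <;> fin_cases b <;> simp [h1.apply_self, hsym.apply]
    rw [hM, Matrix.det_hollow_fin_four]
    linear_combination (B i j * B k l - B i k * B j l + 2 * (B i l * B j k)) * h
      - B i l * B j k * h' - B i l * B j k * (B i j * B k l) * h3

/-- For a fixed pair `i, j`, no three further indices give equal products `B i x * B j x`. -/
lemma eprA.not_three_products_eq (hsym : B.IsSymm) (h1 : eprN B 1) (h2 : eprA B 2)
    (h4 : eprA B 4) {i j k l m : Fin n} (hij : i ≠ j) (hik : i ≠ k) (hil : i ≠ l) (him : i ≠ m)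
    (hjk : j ≠ k) (hjl : j ≠ l) (hjm : j ≠ m) (hkl : k ≠ l) (hkm : k ≠ m) (hlm : l ≠ m) :
    ¬ (B i k * B j k = B i l * B j l ∧ B i k * B j k = B i m * B j m) := by
  have key : ∀ {x y : Fin n}, i ≠ x → i ≠ y → j ≠ x → j ≠ y → x ≠ y →
      B i x * B j x = B i y * B j y → B i j * B x y = -(B i x * B j y) := by
    intro x y hix hiy hjx hjy hxy h
    have hswap := ZMod.cross_mul_eq_of_mul_eq (h2.apply_ne_zero h1 hix) (h2.apply_ne_zero h1 hiy) h
    have hne := h4.not_matching_products_eq hsym h1 hij hix hiy hjx hjy hxy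
    exact ZMod.eq_neg_of_ne_three
      (mul_ne_zero (h2.apply_ne_zero h1 hij) (h2.apply_ne_zero h1 hxy))
      (mul_ne_zero (h2.apply_ne_zero h1 hix) (h2.apply_ne_zero h1 hjy))
      fun he => hne ⟨he, he.trans hswap⟩
  rintro ⟨hl, hm⟩
  have hij0 := h2.apply_ne_zero h1 hij
  have ekl := key hik hil hjk hjl hkl hl
  have ekm := key hik him hjk hjm hkm hm
  have elm := key hil him hjl hjm hlm (hl.symm.trans hm)
  refine h4.not_matching_products_eq hsym h1 hik hil him hkl hkm hlm ⟨?_, ?_⟩ <;>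
    apply mul_left_cancel₀ hij0
  · linear_combination B i k * elm - B i l * ekm
  · linear_combination B i k * elm - B i m * ekl - B i k * ZMod.cross_mul_eq_of_mul_eq
      (h2.apply_ne_zero h1 hil) (h2.apply_ne_zero h1 him) (hl.symm.trans hm)

lemma eprA.le_six (hsym : B.IsSymm) (h1 : eprN B 1) (h2 : eprA B 2) (h4 : eprA B 4) :
    n ≤ 6 := by
  by_contra! hn
  let e : Fin 7 ↪ Fin n := Fin.castLEEmb hn
  have hne : ∀ {a b : Fin 7}, a ≠ b → e a ≠ e b := fun h => e.injective.ne h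
  have h0 : ∀ x : Fin 5, (0 : Fin 7) ≠ x.succ.succ := by decide
  have h1' : ∀ x : Fin 5, (1 : Fin 7) ≠ x.succ.succ := by decide
  obtain ⟨k, l, m, hkl, hkm, hlm, hl, hm⟩ := ZMod.exists_three_eq_of_five
    (y := fun x => B (e 0) (e x.succ.succ) * B (e 1) (e x.succ.succ))
    fun x => mul_ne_zero (h2.apply_ne_zero h1 (hne (h0 x))) (h2.apply_ne_zero h1 (hne (h1' x)))
  exact h2.not_three_products_eq hsym h1 h4 (hne (by decide)) (hne (h0 k)) (hne (h0 l))
    (hne (h0 m)) (hne (h1' k)) (hne (h1' l)) (hne (h1' m)) (hne (by simpa)) (hne (by simpa))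
    (hne (by simpa)) ⟨hl, hm⟩

lemma eprA.three (hsym : B.IsSymm) (h1 : eprN B 1) (h2 : eprA B 2) : eprA B 3 := by
  intro f hf
  have h (a b : Fin 3) (hab : a ≠ b) : B (f a) (f b) ≠ 0 := h2.apply_ne_zero h1 (hf.ne hab)
  have hdet : (B.submatrix f f).det = 2 * (B (f 0) (f 1) * B (f 0) (f 2) * B (f 1) (f 2)) := by
    simp [Matrix.det_fin_three, h1.apply_self, hsym.apply (f 0) (f 1), hsym.apply (f 0) (f 2),
      hsym.apply (f 1) (f 2)]
    ring
  rw [hdet]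
  exact mul_ne_zero (by decide) (mul_ne_zero (mul_ne_zero (h 0 1 (by decide)) (h 0 2 (by decide)))
    (h 1 2 (by decide)))

lemma eprN.submatrix {m j : ℕ} {f : Fin m → Fin n} (h : eprN B j) (hf : f.Injective) :
    eprN (B.submatrix f f) j := fun g hg => h (f ∘ g) (hf.comp hg)

lemma eprA.submatrix {m j : ℕ} {f : Fin m → Fin n} (h : eprA B j) (hf : f.Injective) :
    eprA (B.submatrix f f) j := fun g hg => h (f ∘ g) (hf.comp hg)

set_option synthInstance.maxHeartbeats 400000 in
set_option synthInstance.maxSize 1000 in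
set_option maxRecDepth 100000 in
lemma det_eq_zero_of_bordered {p q r s t u : ZMod 3} (hp : p ≠ 0) (hq : q ≠ 0) (hr : r ≠ 0)
    (hs : s ≠ 0) (ht : t ≠ 0) (hu : u ≠ 0) (h123 : ¬ (s = q ∧ s = p)) (h124 : ¬ (t = r ∧ t = p))
    (h134 : ¬ (u = r ∧ u = q)) (h234 : ¬ (u = t ∧ u = s))
    (h : ¬ (p * u = q * t ∧ p * u = r * s)) :
    (!![0, 1, 1, 1, 1; 1, 0, p, q, r; 1, p, 0, s, t; 1, q, s, 0, u; 1, r, t, u, 0] :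
      Matrix (Fin 5) (Fin 5) (ZMod 3)).det = 0 := by
  simp [Matrix.det_succ_row_zero, Fin.sum_univ_succ, Fin.succAbove]
  decide +revert

lemma det_eq_zero_of_order_five {M : Matrix (Fin 5) (Fin 5) (ZMod 3)} (hsym : M.IsSymm)
    (h1 : eprN M 1) (h2 : eprA M 2) (h4 : eprA M 4) : M.det = 0 := by
  let c : Fin 5 → ZMod 3 := Fin.cons 1 fun i => M 0 i.succ
  have hc : ∀ i, c i ≠ 0 := by
    intro i
    refine Fin.cases ?_ (fun i => ?_) i
    · exact one_ne_zero
    · exact h2.apply_ne_zero h1 (Fin.succ_ne_zero i).symm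
  have hne (i j : Fin 5) (hij : i ≠ j) : M i j ≠ 0 := h2.apply_ne_zero h1 hij
  have hs (i j k : Fin 5) (hi : 0 ≠ i) (hj : 0 ≠ j) (hk : 0 ≠ k) (hij : i ≠ j) (hik : i ≠ k)
      (hjk : j ≠ k) : ¬ (M 0 j * M j k * M 0 k = M 0 i * M i k * M 0 k ∧
        M 0 j * M j k * M 0 k = M 0 i * M i j * M 0 j) := by
    have ei := ZMod.sq_eq_one_three (hne 0 i hi)
    have ej := ZMod.sq_eq_one_three (hne 0 j hj)
    have ek := ZMod.sq_eq_one_three (hne 0 k hk)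
    rintro ⟨h, h'⟩
    refine h4.not_matching_products_eq hsym h1 hi hj hk hij hik hjk ⟨?_, ?_⟩
    · linear_combination M 0 i * M 0 j * M 0 k * h
        - M 0 i * M j k * (M 0 k * M 0 k * ej + ek) + M 0 j * M i k * (M 0 k * M 0 k * ei + ek)
    · linear_combination M 0 i * M 0 j * M 0 k * h'
        - M 0 i * M j k * (M 0 k * M 0 k * ej + ek) + M 0 k * M i j * (M 0 j * M 0 j * ei + ej)
  have hdet : (diagonal c * M * diagonal c).det = 0 := by
    have hM : diagonal c * M * diagonal c =
        !![0, 1, 1, 1, 1;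
          1, 0, M 0 1 * M 1 2 * M 0 2, M 0 1 * M 1 3 * M 0 3, M 0 1 * M 1 4 * M 0 4;
          1, M 0 1 * M 1 2 * M 0 2, 0, M 0 2 * M 2 3 * M 0 3, M 0 2 * M 2 4 * M 0 4;
          1, M 0 1 * M 1 3 * M 0 3, M 0 2 * M 2 3 * M 0 3, 0, M 0 3 * M 3 4 * M 0 4;
          1, M 0 1 * M 1 4 * M 0 4, M 0 2 * M 2 4 * M 0 4, M 0 3 * M 3 4 * M 0 4, 0] := by
      have h01 := ZMod.sq_eq_one_three (hne 0 1 (by decide))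
      have h02 := ZMod.sq_eq_one_three (hne 0 2 (by decide))
      have h03 := ZMod.sq_eq_one_three (hne 0 3 (by decide))
      have h04 := ZMod.sq_eq_one_three (hne 0 4 (by decide))
      have hc0 : c 0 = 1 := rfl
      have hc1 : c 1 = M 0 1 := rfl
      have hc2 : c 2 = M 0 2 := rfl
      have hc3 : c 3 = M 0 3 := rfl
      have hc4 : c 4 = M 0 4 := rfl
      ext i j
      rw [Matrix.mul_diagonal, Matrix.diagonal_mul]
      fin_cases i <;> fin_cases j <;>
        simp [hc0, hc1, hc2, hc3, hc4, h1.apply_self, h01, h02, h03, h04, hsym.apply 0,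
          hsym.apply 1 2, hsym.apply 1 3, hsym.apply 1 4, hsym.apply 2 3, hsym.apply 2 4,
          hsym.apply 3 4] <;> ring
    have hx (i j k : Fin 5) (hij : i ≠ j) (hik : i ≠ k) (hjk : j ≠ k) :
        M i j * M j k * M i k ≠ 0 :=
      mul_ne_zero (mul_ne_zero (hne i j hij) (hne j k hjk)) (hne i k hik)
    rw [hM]
    refine det_eq_zero_of_bordered (hx _ _ _ ?_ ?_ ?_) (hx _ _ _ ?_ ?_ ?_) (hx _ _ _ ?_ ?_ ?_)
      (hx _ _ _ ?_ ?_ ?_) (hx _ _ _ ?_ ?_ ?_) (hx _ _ _ ?_ ?_ ?_)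
      (hs 1 2 3 ?_ ?_ ?_ ?_ ?_ ?_) (hs 1 2 4 ?_ ?_ ?_ ?_ ?_ ?_) (hs 1 3 4 ?_ ?_ ?_ ?_ ?_ ?_)
      (hs 2 3 4 ?_ ?_ ?_ ?_ ?_ ?_) ?_
    case refine_43 =>
      rintro ⟨h, h'⟩
      have hprod : M 0 1 * M 0 2 * M 0 3 * M 0 4 ≠ 0 :=
        mul_ne_zero (mul_ne_zero (mul_ne_zero (hne 0 1 (by decide)) (hne 0 2 (by decide)))
          (hne 0 3 (by decide))) (hne 0 4 (by decide))
      refine h4.not_matching_products_eq (i := 1) (j := 2) (k := 3) (l := 4) hsym h1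
        (by decide) (by decide) (by decide) (by decide) (by decide) (by decide) ⟨?_, ?_⟩ <;>
        apply mul_left_cancel₀ hprod
      · linear_combination h
      · linear_combination h'
    all_goals decide
  rw [Matrix.det_mul, Matrix.det_mul, Matrix.det_diagonal] at hdet
  have hprod : ∏ i, c i ≠ 0 := Finset.prod_ne_zero_iff.2 fun i _ => hc i
  simpa [hprod] using hdet

lemma mul_self_eq_neg_one_of_order_six {M : Matrix (Fin 6) (Fin 6) (ZMod 3)} (hsym : M.IsSymm)
    (h1 : eprN M 1) (h2 : eprA M 2) (h4 : eprA M 4) : M * M = -1 := by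
  ext i j
  simp_rw [Matrix.mul_apply, hsym.apply j]
  obtain rfl | hij := eq_or_ne i j
  · rw [← Finset.add_sum_erase _ _ (Finset.mem_univ i), h1.apply_self,
      Finset.sum_congr rfl fun k hk =>
        ZMod.sq_eq_one_three (h2.apply_ne_zero h1 (Finset.ne_of_mem_erase hk).symm)]
    simp
    decide
  · have hcard : (({i, j} : Finset (Fin 6))ᶜ).card = 4 := by
      rw [Finset.card_compl, Finset.card_pair hij, Fintype.card_fin]
    let e := (({i, j} : Finset (Fin 6))ᶜ.equivFinOfCardEq hcard).symm
    have he (x : Fin 4) : i ≠ e x ∧ j ≠ e x := by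
      have := (e x).2
      simp only [Finset.mem_compl, Finset.mem_insert, Finset.mem_singleton, not_or] at this
      exact ⟨Ne.symm this.1, Ne.symm this.2⟩
    have hinj {x y : Fin 4} (hxy : x ≠ y) : (e x : Fin 6) ≠ e y :=
      fun h => hxy (e.injective (Subtype.ext h))
    have hprod (x : Fin 4) : M i (e x) * M j (e x) ≠ 0 :=
      mul_ne_zero (h2.apply_ne_zero h1 (he x).1) (h2.apply_ne_zero h1 (he x).2)
    have hthree (x y z : Fin 4) (hxy : x ≠ y) (hxz : x ≠ z) (hyz : y ≠ z) :=
      h2.not_three_products_eq hsym h1 h4 hij (he x).1 (he y).1 (he z).1 (he x).2 (he y).2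
        (he z).2 (hinj hxy) (hinj hxz) (hinj hyz)
    rw [← Finset.sum_add_sum_compl {i, j}, Finset.sum_pair hij, h1.apply_self, h1.apply_self,
      ← Finset.sum_coe_sort, ← e.sum_comp, Fin.sum_univ_four,
      ZMod.add_eq_zero_of_no_three_eq (hprod 0) (hprod 1) (hprod 2) (hprod 3)
        (hthree 0 1 2 (by decide) (by decide) (by decide))
        (hthree 0 1 3 (by decide) (by decide) (by decide))
        (hthree 0 2 3 (by decide) (by decide) (by decide))
        (hthree 1 2 3 (by decide) (by decide) (by decide))]
    simp [hij]

end HollowSymmetric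

theorem stmt16 {n : ℕ} (hn : 4 ≤ n)
    (B : Matrix (Fin n) (Fin n) (ZMod 3)) (hsym : B.IsSymm)
    (h1 : eprN B 1) (h2 : eprA B 2) (h4 : eprA B 4) :
    n ≤ 6 ∧ eprA B 3 ∧ (5 ≤ n → eprN B 5) ∧ (n = 6 → eprA B 6) := by
  refine ⟨h2.le_six hsym h1 h4, h2.three hsym h1, fun _ f hf => ?_, fun _ f hf hdet => ?_⟩
  · exact det_eq_zero_of_order_five (hsym.submatrix f) (h1.submatrix hf) (h2.submatrix hf)
      (h4.submatrix hf)
  · have h := congrArg Matrix.det (mul_self_eq_neg_one_of_order_six (hsym.submatrix f)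
      (h1.submatrix hf) (h2.submatrix hf) (h4.submatrix hf))
    rw [Matrix.det_mul, hdet, Matrix.det_neg] at h
    revert h
    simp
    decide
end
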